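/- arXiv:2411.16397 — 2 statements merged into one kernel-verified Lean document; each statement's English description precedes it below -/
import Mathlib

section
/- (Countably infinite alphabet property for full complement.) For all KA_{−} terms t and s: LANG ⊨ t ≤ s if and only if LANG_{ℵ₀} ⊨ t ≤ s, i.e., v̂(t) ⊆ v̂(s) holds for all valuations over all sets if and only if it holds for all valuations over countable sets. -/
/-- Kleene algebra terms with full complement (`KA_{−}` terms), over the
countably infinite variable set `ℕ`. -/
inductive CTerm : Type where
  | var : ℕ → CTerm
  | zero : CTerm
  | one : CTerm
  | add : CTerm → CTerm → CTerm
  | comp : CTerm → CTerm → CTerm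
  | star : CTerm → CTerm
  | compl : CTerm → CTerm

/-- Composition (concatenation) of languages. -/
def cat {X : Type} (L M : Set (List X)) : Set (List X) :=
  {w | ∃ u ∈ L, ∃ v ∈ M, w = u ++ v}

/-- Kleene star of a language. -/
def kstar {X : Type} (L : Set (List X)) : Set (List X) :=
  {w | ∃ ws : List (List X), (∀ u ∈ ws, u ∈ L) ∧ w = ws.flatten}

/-- The interpretation `v̂(t)` of a `KA_{−}` term under a valuation
`v : V → P(X*)`, with `v̂(t^−) = X* ∖ v̂(t)`. -/
def eval {X : Type} (v : ℕ → Set (List X)) : CTerm → Set (List X)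
  | .var x => v x
  | .zero => ∅
  | .one => {[]}
  | .add t s => eval v t ∪ eval v s
  | .comp t s => cat (eval v t) (eval v s)
  | .star t => kstar (eval v t)
  | .compl t => (eval v t)ᶜ

/-- A factorisation of `w.map f` into a list of words lifts along `f` to a factorisation of `w`. -/
theorem exists_flatten_of_map_eq_flatten {X Y : Type} (f : Y → X) (ws : List (List X)) :
    ∀ w : List Y, w.map f = ws.flatten →
      ∃ us : List (List Y), us.map (List.map f) = ws ∧ w = us.flatten := by
  induction ws with
  | nil =>
    intro w h
    exact ⟨[], rfl, by simpa using h⟩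
  | cons a ws ih =>
    intro w h
    rw [List.flatten_cons, List.map_eq_append_iff] at h
    obtain ⟨u, w', rfl, rfl, h⟩ := h
    obtain ⟨us, rfl, rfl⟩ := ih w' h
    exact ⟨u :: us, rfl, rfl⟩

/-- Evaluation commutes with taking preimages under a letter-to-letter substitution. -/
theorem map_mem_eval_iff {X Y : Type} (f : Y → X) (v : ℕ → Set (List X)) (t : CTerm) :
    ∀ w : List Y, w.map f ∈ eval v t ↔ w ∈ eval (fun n => List.map f ⁻¹' v n) t := by
  induction t with
  | var n => intro w; rfl
  | zero => intro w; rfl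
  | one => intro w; simp [eval]
  | add t s iht ihs => intro w; exact or_congr (iht w) (ihs w)
  | compl t ih => intro w; exact not_congr (ih w)
  | comp t s iht ihs =>
    intro w
    constructor
    · rintro ⟨a, ha, b, hb, h⟩
      obtain ⟨u, u', rfl, rfl, rfl⟩ := List.map_eq_append_iff.1 h
      exact ⟨u, (iht u).1 ha, u', (ihs u').1 hb, rfl⟩
    · rintro ⟨u, hu, u', hu', rfl⟩
      exact ⟨u.map f, (iht u).2 hu, u'.map f, (ihs u').2 hu', List.map_append⟩
  | star t ih =>
    intro w
    constructor
    · rintro ⟨ws, hws, h⟩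
      obtain ⟨us, rfl, rfl⟩ := exists_flatten_of_map_eq_flatten f ws w h
      exact ⟨us, fun u hu => (ih u).1 (hws _ (List.mem_map_of_mem hu)), rfl⟩
    · rintro ⟨us, hus, rfl⟩
      refine ⟨us.map (List.map f), fun a ha => ?_, List.map_flatten⟩
      obtain ⟨u, hu, rfl⟩ := List.mem_map.1 ha
      exact (ih u).2 (hus u hu)

/-- Countably infinite alphabet property for full complement: for `KA_{−}`
terms `t`, `s`, `LANG ⊨ t ≤ s` iff `LANG_{ℵ₀} ⊨ t ≤ s` (valuations over
countable sets). -/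
theorem stmt14 (t s : CTerm) :
    (∀ (X : Type) (v : ℕ → Set (List X)), eval v t ⊆ eval v s) ↔
    (∀ (X : Type), Countable X →
      ∀ v : ℕ → Set (List X), eval v t ⊆ eval v s) := by
  refine ⟨fun h X _ v => h X v, fun h X v w hw => ?_⟩
  have key := fun r => map_mem_eval_iff w.get v r (List.finRange w.length)
  simp only [List.map_get_finRange] at key
  exact (key s).2 (h (Fin w.length) inferInstance _ ((key t).1 hw))
end

section
/- Let n ≥ 1 and let x_0, …, x_n ∈ V be pairwise distinct variables. Define the KA_{−} terms t₁ = (⊤ ; ((x_0 + ⋯ + x_n)*)^− ; ⊤)^− and t₂ = Σ_{j=0}^{n} (⊤ ; ((Σ_{i ∈ {0,…,n} ∖ {j}} x_i)*)^− ; ⊤)^−, where ⊤ = 0^−. Then: (i) LANG_n ⊨ t₁ ≤ t₂, i.e., v̂(t₁) ⊆ v̂(t₂) for every valuation over a set of cardinality at most n; (ii) LANG_{n+1} ⊭ t₁ ≤ t₂, i.e., there is a valuation over a set of cardinality n+1 with v̂(t₁) ⊄ v̂(t₂). -/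
/-- `⊤ = 0⁻`. -/
def top : CTerm := .compl .zero

/-- The sum `0 + t_1 + ⋯ + t_k` of a list of terms. -/
def sumList (l : List CTerm) : CTerm := l.foldr .add .zero

/-- `(⊤ ; (s*)⁻ ; ⊤)⁻`. -/
def boxTerm (s : CTerm) : CTerm :=
  .compl (.comp top (.comp (.compl (.star s)) top))

/-- `t₁ = (⊤ ; ((x_0 + ⋯ + x_n)*)⁻ ; ⊤)⁻`. -/
def sepT1 (n : ℕ) (x : Fin (n + 1) → ℕ) : CTerm :=
  boxTerm (sumList ((List.finRange (n + 1)).map (fun i => .var (x i))))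

/-- `t₂ = Σ_{j=0}^{n} (⊤ ; ((Σ_{i ≠ j} x_i)*)⁻ ; ⊤)⁻`. -/
def sepT2 (n : ℕ) (x : Fin (n + 1) → ℕ) : CTerm :=
  sumList ((List.finRange (n + 1)).map (fun j =>
    boxTerm (sumList (((List.finRange (n + 1)).filter
      (fun i => decide (i ≠ j))).map (fun i => .var (x i))))))

theorem mem_eval_sumList {X : Type} (v : ℕ → Set (List X)) (l : List CTerm) (w : List X) :
    w ∈ eval v (sumList l) ↔ ∃ t ∈ l, w ∈ eval v t := by
  induction l with
  | nil => simp [sumList, eval]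
  | cons a l ih =>
    have h : eval v (sumList (a :: l)) = eval v a ∪ eval v (sumList l) := rfl
    simp [h, ih]

/-- A one-letter word lies in `L*` exactly when it lies in `L`. -/
theorem singleton_mem_kstar {X : Type} (L : Set (List X)) (a : X) :
    [a] ∈ kstar L ↔ [a] ∈ L := by
  constructor
  · rintro ⟨ws, hws, h⟩
    induction ws with
    | nil => simp at h
    | cons u ws ih =>
      rw [List.flatten_cons, eq_comm, List.append_eq_singleton_iff] at h
      rcases h with ⟨-, h⟩ | ⟨rfl, -⟩
      · exact ih (fun u hu => hws u (List.mem_cons_of_mem _ hu)) h.symm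
      · exact hws _ List.mem_cons_self
  · intro h
    exact ⟨[[a]], by simpa using h, by simp⟩

theorem mem_kstar_of_forall_singleton {X : Type} {L : Set (List X)} {w : List X}
    (h : ∀ a ∈ w, [a] ∈ L) : w ∈ kstar L := by
  refine ⟨w.map fun a => [a], by simpa using h, ?_⟩
  induction w with
  | nil => rfl
  | cons a w ih => simpa using ih fun b hb => h b (List.mem_cons_of_mem _ hb)

/-- A word belongs to `(⊤ ; (s*)⁻ ; ⊤)⁻` exactly when each of its letters, read as a one-letter
word, belongs to `s`. -/
theorem mem_eval_boxTerm {X : Type} (v : ℕ → Set (List X)) (s : CTerm) (w : List X) :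
    w ∈ eval v (boxTerm s) ↔ ∀ a ∈ w, [a] ∈ eval v s := by
  constructor
  · intro h a ha
    by_contra hna
    obtain ⟨p, q, rfl⟩ := List.append_of_mem ha
    refine h ⟨p, by simp [top, eval], [a] ++ q, ⟨[a], ?_, q, by simp [top, eval], rfl⟩, by simp⟩
    exact fun hk => hna ((singleton_mem_kstar _ _).1 hk)
  · rintro h ⟨p, -, _, ⟨m, hm, q, -, rfl⟩, rfl⟩
    exact hm (mem_kstar_of_forall_singleton fun a ha => h a (by simp [ha]))

theorem mem_eval_sepT1 {X : Type} (v : ℕ → Set (List X)) (n : ℕ) (x : Fin (n + 1) → ℕ)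
    (w : List X) :
    w ∈ eval v (sepT1 n x) ↔ ∀ a ∈ w, ∃ i, [a] ∈ v (x i) := by
  simp [sepT1, mem_eval_boxTerm, mem_eval_sumList, eval]

theorem mem_eval_sepT2 {X : Type} (v : ℕ → Set (List X)) (n : ℕ) (x : Fin (n + 1) → ℕ)
    (w : List X) :
    w ∈ eval v (sepT2 n x) ↔ ∃ j, ∀ a ∈ w, ∃ i, i ≠ j ∧ [a] ∈ v (x i) := by
  simp [sepT2, mem_eval_boxTerm, mem_eval_sumList, eval]

/-- For `n ≥ 1` and pairwise distinct variables `x_0, …, x_n`: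
(i) `LANG_n ⊨ t₁ ≤ t₂`; (ii) `LANG_{n+1} ⊭ t₁ ≤ t₂`, witnessed by a valuation
over a set of cardinality `n + 1`. -/
theorem stmt18 (n : ℕ) (hn : 1 ≤ n) (x : Fin (n + 1) → ℕ)
    (hx : Function.Injective x) :
    (∀ (X : Type), Cardinal.mk X ≤ n →
      ∀ v : ℕ → Set (List X), eval v (sepT1 n x) ⊆ eval v (sepT2 n x)) ∧
    (∃ (X : Type) (_ : Cardinal.mk X = n + 1) (v : ℕ → Set (List X)),
      ¬ eval v (sepT1 n x) ⊆ eval v (sepT2 n x)) := by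
  constructor
  · intro X hX v w hw
    rw [mem_eval_sepT1] at hw
    rw [mem_eval_sepT2]
    have hf : ∀ a : X, ∃ i, a ∈ w → [a] ∈ v (x i) := fun a => by
      by_cases ha : a ∈ w
      · exact (hw a ha).imp fun _ h _ => h
      · exact ⟨0, fun h => absurd h ha⟩
    choose f hf using hf
    have hns : ¬ Function.Surjective f := fun hs => by
      have h := (Cardinal.mk_le_of_surjective hs).trans hX
      rw [Cardinal.mk_fin, Nat.cast_le] at h
      omega
    rw [Function.Surjective] at hns
    push Not at hns
    obtain ⟨j, hj⟩ := hns
    exact ⟨j, fun a ha => ⟨f a, hj a, hf a ha⟩⟩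
  · refine ⟨Fin (n + 1), by simp, fun m => {w | ∃ i, x i = m ∧ w = [i]}, fun h => ?_⟩
    have hw := h ((mem_eval_sepT1 _ n x (List.finRange (n + 1))).2
      fun a _ => ⟨a, a, rfl, rfl⟩)
    obtain ⟨j, hj⟩ := (mem_eval_sepT2 _ n x _).1 hw
    obtain ⟨i, hij, k, hk, hjk⟩ := hj j (List.mem_finRange j)
    exact hij ((hx hk).symm.trans (List.singleton_inj.1 hjk).symm)
end
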